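/- Let c > 0 be the universal constant for which Λ has the singular integral representation with kernel K(y) = −(2c/F³)(y₁² + y₂² − 3y₃²/F²)/|y|_{1/F}⁶. Then for all Schwartz functions f and g on ℝ³ and every x ∈ ℝ³, the integral M(f,g)(x) = ∫_{ℝ³} K(y)(f(x−y) − f(x))(g(x−y) − g(x)) dy converges absolutely and Λ(fg)(x) = f(x)·Λg(x) + g(x)·Λf(x) + M(f,g)(x). -/

import Mathlib

open MeasureTheory
open scoped Real FourierTransform SchwartzMap

noncomputable section

/-- `|ξ|_F² = ξ₁² + ξ₂² + F²ξ₃²`. -/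
def normFsq (F : ℝ) (ξ : EuclideanSpace ℝ (Fin 3)) : ℝ :=
  ξ 0 ^ 2 + ξ 1 ^ 2 + F ^ 2 * ξ 2 ^ 2

/-- `|x|_{1/F}² = x₁² + x₂² + x₃²/F²`. -/
def normInvFsq (F : ℝ) (x : EuclideanSpace ℝ (Fin 3)) : ℝ :=
  x 0 ^ 2 + x 1 ^ 2 + x 2 ^ 2 / F ^ 2

/-- The operator `Λ = ∂₃²(−Δ_F)^{−1/2}`: the Fourier multiplier with symbol `−ξ₃²/|ξ|_F`. -/
def Lambda (F : ℝ) (f : EuclideanSpace ℝ (Fin 3) → ℂ) :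
    EuclideanSpace ℝ (Fin 3) → ℂ :=
  fun x => 𝓕⁻ (fun ξ => ((-(ξ 2 ^ 2) / Real.sqrt (normFsq F ξ) : ℝ) : ℂ) * 𝓕 f ξ) x

/-- The kernel `K(y) = −(2c/F³)(y₁² + y₂² − 3y₃²/F²)/|y|_{1/F}⁶`. -/
def Kker (c F : ℝ) (y : EuclideanSpace ℝ (Fin 3)) : ℝ :=
  -(2 * c / F ^ 3) * (y 0 ^ 2 + y 1 ^ 2 - 3 * y 2 ^ 2 / F ^ 2) / (normInvFsq F y) ^ 3

theorem norm_sq_le_normInvFsq {F : ℝ} (hF : F ∈ Set.Ioc (0 : ℝ) 1)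
    (y : EuclideanSpace ℝ (Fin 3)) : ‖y‖ ^ 2 ≤ normInvFsq F y := by
  have hF2 : 0 < F ^ 2 := pow_pos hF.1 2
  have h : y 2 ^ 2 ≤ y 2 ^ 2 / F ^ 2 := by
    rw [le_div_iff₀ hF2]
    exact mul_le_of_le_one_right (sq_nonneg _) (pow_le_one₀ hF.1.le hF.2)
  rw [EuclideanSpace.norm_sq_eq, Fin.sum_univ_three]
  simp only [Real.norm_eq_abs, sq_abs, normInvFsq]
  linarith

theorem Kker_neg (c F : ℝ) (y : EuclideanSpace ℝ (Fin 3)) : Kker c F (-y) = Kker c F y := by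
  simp [Kker, normInvFsq]

theorem measurable_Kker (c F : ℝ) : Measurable (Kker c F) := by
  unfold Kker normInvFsq
  fun_prop

theorem abs_Kker_mul_norm_pow_four_le {c F : ℝ} (hc : 0 < c) (hF : F ∈ Set.Ioc (0 : ℝ) 1)
    (y : EuclideanSpace ℝ (Fin 3)) : |Kker c F y| * ‖y‖ ^ 4 ≤ 6 * c / F ^ 3 := by
  have hF3 : 0 < F ^ 3 := pow_pos hF.1 3
  have hC : 0 < 6 * c / F ^ 3 := by positivity
  rcases eq_or_ne y 0 with rfl | hy
  · simpa using hC.le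
  have hle := norm_sq_le_normInvFsq hF y
  have hN : 0 < normInvFsq F y := lt_of_lt_of_le (by positivity) hle
  have hnum : |y 0 ^ 2 + y 1 ^ 2 - 3 * y 2 ^ 2 / F ^ 2| ≤ 3 * normInvFsq F y := by
    have h2 : 0 ≤ y 2 ^ 2 / F ^ 2 := by positivity
    rw [abs_le, normInvFsq, mul_div_assoc]
    constructor <;> nlinarith [sq_nonneg (y 0), sq_nonneg (y 1)]
  have h4 : ‖y‖ ^ 4 ≤ normInvFsq F y ^ 2 := by
    calc ‖y‖ ^ 4 = (‖y‖ ^ 2) ^ 2 := by ring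
      _ ≤ _ := pow_le_pow_left₀ (by positivity) hle 2
  calc |Kker c F y| * ‖y‖ ^ 4
      = 2 * c / F ^ 3 * |y 0 ^ 2 + y 1 ^ 2 - 3 * y 2 ^ 2 / F ^ 2| / normInvFsq F y ^ 3
          * ‖y‖ ^ 4 := by
        rw [Kker, abs_div, abs_mul, abs_neg, abs_of_pos (show 0 < 2 * c / F ^ 3 by positivity),
          abs_of_pos (pow_pos hN 3)]
    _ ≤ 2 * c / F ^ 3 * (3 * normInvFsq F y) / normInvFsq F y ^ 3 * normInvFsq F y ^ 2 := by
        gcongr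
    _ = 6 * c / F ^ 3 := by
        field_simp
        ring

theorem integrable_inv_norm_sq_mul_one_add_norm_sq :
    Integrable (fun y : EuclideanSpace ℝ (Fin 3) => (‖y‖ ^ 2 * (1 + ‖y‖ ^ 2))⁻¹) := by
  rw [integrable_fun_norm_addHaar volume (f := fun r : ℝ => (r ^ 2 * (1 + r ^ 2))⁻¹)]
  refine (integrable_inv_one_add_sq.integrableOn (s := Set.Ioi 0)).congr_fun ?_ measurableSet_Ioi
  intro r (hr : 0 < r)
  simp only [finrank_euclideanSpace, Fintype.card_fin, smul_eq_mul]
  field_simp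

/-- The kernel `K` is integrable against bounded functions that vanish to second order at `0`. -/
theorem integrable_Kker_mul {c F : ℝ} (hc : 0 < c) (hF : F ∈ Set.Ioc (0 : ℝ) 1)
    {u : EuclideanSpace ℝ (Fin 3) → ℂ} (hu : Continuous u) {A B : ℝ}
    (hA : ∀ y, ‖u y‖ ≤ A) (hB : ∀ y, ‖u y‖ ≤ B * ‖y‖ ^ 2) :
    Integrable (fun y => ((Kker c F y : ℝ) : ℂ) * u y) := by
  refine (integrable_inv_norm_sq_mul_one_add_norm_sq.const_mul
    (6 * c / F ^ 3 * (A + B))).mono' ?_ (.of_forall fun y => ?_)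
  · exact ((Complex.measurable_ofReal.comp (measurable_Kker c F)).mul
      hu.measurable).aestronglyMeasurable
  rcases eq_or_ne y 0 with rfl | hy
  · simp [Kker, normInvFsq]
  have hy' : 0 < ‖y‖ := norm_pos_iff.mpr hy
  have hK := abs_Kker_mul_norm_pow_four_le hc hF y
  have hu' : ‖u y‖ * (1 + ‖y‖ ^ 2) ≤ (A + B) * ‖y‖ ^ 2 := by
    nlinarith [hB y, mul_le_mul_of_nonneg_right (hA y) (sq_nonneg ‖y‖)]
  rw [norm_mul, Complex.norm_real, Real.norm_eq_abs, ← div_eq_mul_inv,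
    le_div_iff₀ (by positivity)]
  refine le_of_mul_le_mul_right ?_ (pow_pos hy' 2)
  calc |Kker c F y| * ‖u y‖ * (‖y‖ ^ 2 * (1 + ‖y‖ ^ 2)) * ‖y‖ ^ 2
      = (|Kker c F y| * ‖y‖ ^ 4) * (‖u y‖ * (1 + ‖y‖ ^ 2)) := by ring
    _ ≤ 6 * c / F ^ 3 * ((A + B) * ‖y‖ ^ 2) :=
        mul_le_mul hK hu' (by positivity) ((by positivity : (0:ℝ) ≤ _).trans hK)
    _ = 6 * c / F ^ 3 * (A + B) * ‖y‖ ^ 2 := by ring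

namespace SchwartzMap

variable {E G : Type*} [NormedAddCommGroup E] [NormedSpace ℝ E]
  [NormedAddCommGroup G] [NormedSpace ℝ G]

theorem exists_norm_sub_le (f : 𝓢(E, G)) : ∃ L, 0 ≤ L ∧ ∀ a b, ‖f a - f b‖ ≤ L * ‖a - b‖ := by
  refine ⟨SchwartzMap.seminorm ℝ 0 0 (fderivCLM ℝ E G f), apply_nonneg _ _, fun a b => ?_⟩
  refine convex_univ.norm_image_sub_le_of_norm_fderiv_le (𝕜 := ℝ)
    (fun x _ => f.differentiableAt) (fun x _ => ?_) (Set.mem_univ b) (Set.mem_univ a)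
  rw [← fderivCLM_apply ℝ]
  exact norm_le_seminorm ℝ _ x

theorem exists_norm_second_difference_le (f : 𝓢(E, G)) :
    ∃ L, ∀ x y, ‖f (x - y) + f (x + y) - (2 : ℝ) • f x‖ ≤ L * ‖y‖ ^ 2 := by
  obtain ⟨L, -, hf'⟩ := (fderivCLM ℝ E G f).exists_norm_sub_le
  refine ⟨L, fun x y => ?_⟩
  have hd (z : E) : HasFDerivAt (fun z => f (z + y) - f z)
      (fderiv ℝ f (z + y) - fderiv ℝ f z) z :=
    ((hasFDerivAt_comp_add_right y).mpr f.differentiableAt.hasFDerivAt).sub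
      f.differentiableAt.hasFDerivAt
  have key := convex_univ.norm_image_sub_le_of_norm_fderiv_le (𝕜 := ℝ)
    (f := fun z => f (z + y) - f z) (C := L * ‖y‖) (fun z _ => (hd z).differentiableAt)
    (fun z _ => by
      rw [(hd z).fderiv, ← fderivCLM_apply ℝ, ← fderivCLM_apply ℝ]
      simpa using hf' (z + y) z) (Set.mem_univ (x - y)) (Set.mem_univ x)
  calc ‖f (x - y) + f (x + y) - (2 : ℝ) • f x‖
      = ‖f (x + y) - f x - (f (x - y + y) - f (x - y))‖ := by
        rw [sub_add_cancel, two_smul]; congr 1; abel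
    _ ≤ L * ‖y‖ * ‖x - (x - y)‖ := key
    _ = L * ‖y‖ ^ 2 := by rw [sub_sub_cancel]; ring

end SchwartzMap

theorem integrable_Kker_mul_second_difference {c F : ℝ} (hc : 0 < c)
    (hF : F ∈ Set.Ioc (0 : ℝ) 1) (f : 𝓢(EuclideanSpace ℝ (Fin 3), ℂ))
    (x : EuclideanSpace ℝ (Fin 3)) :
    Integrable (fun y => ((Kker c F y : ℝ) : ℂ) * (f (x - y) + f (x + y) - 2 * f x)) := by
  obtain ⟨L, hL⟩ := f.exists_norm_second_difference_le
  have hf := f.norm_le_seminorm ℝ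
  set S := SchwartzMap.seminorm ℝ 0 0 f
  refine integrable_Kker_mul hc hF (A := S + S + 2 * S) (B := L) (by fun_prop)
    (fun y => ?_) (fun y => by simpa using hL x y)
  refine (norm_sub_le _ _).trans (add_le_add ((norm_add_le _ _).trans
    (add_le_add (hf _) (hf _))) ?_)
  simpa using hf x

theorem integrable_Kker_mul_sub_mul_sub {c F : ℝ} (hc : 0 < c)
    (hF : F ∈ Set.Ioc (0 : ℝ) 1) (f g : 𝓢(EuclideanSpace ℝ (Fin 3), ℂ))
    (x : EuclideanSpace ℝ (Fin 3)) :
    Integrable (fun y => ((Kker c F y : ℝ) : ℂ) * (f (x - y) - f x) * (g (x - y) - g x)) := by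
  obtain ⟨L, hL, hfL⟩ := f.exists_norm_sub_le
  obtain ⟨M, hM, hgM⟩ := g.exists_norm_sub_le
  have hf := f.norm_le_seminorm ℝ
  have hg := g.norm_le_seminorm ℝ
  set S := SchwartzMap.seminorm ℝ 0 0 f
  set T := SchwartzMap.seminorm ℝ 0 0 g
  have hS : 0 ≤ S := (norm_nonneg _).trans (hf 0)
  simp only [mul_assoc]
  refine integrable_Kker_mul hc hF (A := (S + S) * (T + T)) (B := L * M) (by fun_prop)
    (fun y => ?_) (fun y => ?_)
  · rw [norm_mul]
    exact mul_le_mul ((norm_sub_le _ _).trans (add_le_add (hf _) (hf _)))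
      ((norm_sub_le _ _).trans (add_le_add (hg _) (hg _))) (norm_nonneg _) (by positivity)
  · have h1 : ‖f (x - y) - f x‖ ≤ L * ‖y‖ := by simpa using hfL (x - y) x
    have h2 : ‖g (x - y) - g x‖ ≤ M * ‖y‖ := by simpa using hgM (x - y) x
    rw [norm_mul]
    calc _ ≤ L * ‖y‖ * (M * ‖y‖) := mul_le_mul h1 h2 (norm_nonneg _) (by positivity)
      _ = L * M * ‖y‖ ^ 2 := by ring

/-- Product rule for `Λ`: if `c` is the universal constant for which `Λ` has the singular
integral representation with kernel `K`, then for Schwartz `f, g`,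
`Λ(fg) = f Λg + g Λf + M(f,g)`, with `M(f,g)(x) = ∫ K(y)(f(x−y)−f(x))(g(x−y)−g(x)) dy`
absolutely convergent. -/
theorem Lambda_product_rule
    (c : ℝ) (hc : 0 < c)
    (hrep : ∀ F : ℝ, F ∈ Set.Ioc (0 : ℝ) 1 →
      ∀ f : 𝓢(EuclideanSpace ℝ (Fin 3), ℂ), ∀ x : EuclideanSpace ℝ (Fin 3),
        Lambda F ⇑f x =
          (1 / 2 : ℂ) *
            ∫ y : EuclideanSpace ℝ (Fin 3),
              ((Kker c F y : ℝ) : ℂ) * (f (x - y) + f (x + y) - 2 * f x))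
    (F : ℝ) (hF : F ∈ Set.Ioc (0 : ℝ) 1)
    (f g : 𝓢(EuclideanSpace ℝ (Fin 3), ℂ)) (x : EuclideanSpace ℝ (Fin 3)) :
    Integrable (fun y : EuclideanSpace ℝ (Fin 3) =>
      ((Kker c F y : ℝ) : ℂ) * (f (x - y) - f x) * (g (x - y) - g x)) volume ∧
    Lambda F (fun z => f z * g z) x =
      f x * Lambda F ⇑g x + g x * Lambda F ⇑f x +
        ∫ y : EuclideanSpace ℝ (Fin 3),
          ((Kker c F y : ℝ) : ℂ) * (f (x - y) - f x) * (g (x - y) - g x) := by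
  have hM := integrable_Kker_mul_sub_mul_sub hc hF f g x
  refine ⟨hM, ?_⟩
  have hM' : Integrable fun y : EuclideanSpace ℝ (Fin 3) =>
      ((Kker c F y : ℝ) : ℂ) * (f (x + y) - f x) * (g (x + y) - g x) := by
    simpa [Kker_neg] using hM.comp_neg
  have hMeq : ∫ y, ((Kker c F y : ℝ) : ℂ) * (f (x + y) - f x) * (g (x + y) - g x)
      = ∫ y, ((Kker c F y : ℝ) : ℂ) * (f (x - y) - f x) * (g (x - y) - g x) := by
    rw [← integral_neg_eq_self]
    simp [Kker_neg, sub_eq_add_neg]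
  have hDf := (integrable_Kker_mul_second_difference hc hF f x).const_mul (g x)
  have hDg := (integrable_Kker_mul_second_difference hc hF g x).const_mul (f x)
  have hfg := hrep F hF (SchwartzMap.pairing (ContinuousLinearMap.mul ℂ ℂ) f g) x
  simp only [SchwartzMap.pairing_apply, ContinuousLinearMap.mul_apply'] at hfg
  have hsplit : ∀ y : EuclideanSpace ℝ (Fin 3), ((Kker c F y : ℝ) : ℂ) *
      (f (x - y) * g (x - y) + f (x + y) * g (x + y) - 2 * (f x * g x)) =
      (f x * (((Kker c F y : ℝ) : ℂ) * (g (x - y) + g (x + y) - 2 * g x)) +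
        g x * (((Kker c F y : ℝ) : ℂ) * (f (x - y) + f (x + y) - 2 * f x))) +
      (((Kker c F y : ℝ) : ℂ) * (f (x - y) - f x) * (g (x - y) - g x) +
        ((Kker c F y : ℝ) : ℂ) * (f (x + y) - f x) * (g (x + y) - g x)) := fun y => by ring
  rw [hfg, hrep F hF f x, hrep F hF g x, integral_congr_ae (.of_forall hsplit),
    integral_add (by exact hDg.add hDf) (by exact hM.add hM'), integral_add hDg hDf,
    integral_add hM hM', hMeq,
    integral_const_mul, integral_const_mul]
  ring
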